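/- arXiv:2007.14225 — 3 statements merged into one kernel-verified Lean document; each statement's English description precedes it below -/
import Mathlib

section
/- Let G = (V,E) be a simple undirected graph with a p-partition 𝒱 = {V_1, ..., V_p} of V, and let q' ≥ 2 and k' ≥ 2 be integers. Construct the graph G' consisting of a copy of G, a complete graph K_{k'-2} on new vertices w_1, ..., w_{k'-2}, and q' new vertices u_1, ..., u_{q'} with no edges among themselves, where additionally every vertex of V is joined by an edge to every vertex of {w_1,...,w_{k'-2}}. Take the partition 𝒱' = 𝒱 ∪ {{w_1}, {w_2}, ..., {w_{k'-2}}, {u_1, u_2, ..., u_{q'}}}. Then there exists a selection S of 𝒱 such that G[S] is 2-colorable if and only if there exists a selection S' of 𝒱' such that G'[S'] is k'-colorable. -/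
/-- The base (pre-symmetrization) edge relation of the padded graph `G'` in the
proof of Corollary 1: it consists of a copy of `G` (on `Sum.inl` vertices), a
complete graph `K_{k'-2}` on the vertices `w₁,…,w_{k'-2}` (the
`Sum.inr (Sum.inl _)` vertices), and `q'` isolated-among-themselves vertices
`u₁,…,u_{q'}` (the `Sum.inr (Sum.inr _)` vertices), where additionally every
vertex of `G` is joined to every vertex of `K_{k'-2}`. -/
def padRel {α : Type*} (G : SimpleGraph α) (k' q' : ℕ) :
    (α ⊕ (Fin (k' - 2) ⊕ Fin q')) → (α ⊕ (Fin (k' - 2) ⊕ Fin q')) → Prop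
  | Sum.inl v, Sum.inl w => G.Adj v w
  | Sum.inl _, Sum.inr (Sum.inl _) => True
  | Sum.inr (Sum.inl _), Sum.inr (Sum.inl _) => True
  | _, _ => False

/-- A `2`-coloring of `G[S]` extends to a `k'`-coloring of the padded graph on any set of vertices
whose trace on `G` is `S`: the clique gets `k' - 2` fresh colors. -/
theorem colorable_induce_fromRel_padRel {α : Type*} {G : SimpleGraph α} {k' q' : ℕ} (hk' : 2 ≤ k')
    {S' : Set (α ⊕ (Fin (k' - 2) ⊕ Fin q'))}
    (h : (G.induce (Sum.inl ⁻¹' S')).Colorable 2) :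
    ((SimpleGraph.fromRel (padRel G k' q')).induce S').Colorable k' := by
  obtain ⟨c⟩ := h
  let f : S' → Fin 2 ⊕ Fin (k' - 2)
    | ⟨Sum.inl v, hv⟩ => Sum.inl (c ⟨v, hv⟩)
    | ⟨Sum.inr (Sum.inl w), _⟩ => Sum.inr w
    | ⟨Sum.inr (Sum.inr _), _⟩ => Sum.inl 0
  have hf : ∀ {a b : S'},
      ((SimpleGraph.fromRel (padRel G k' q')).induce S').Adj a b → f a ≠ f b := by
    rintro ⟨a | a | a, ha⟩ ⟨b | b | b, hb⟩ hab
    · have hG : G.Adj a b := by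
        simpa [padRel, G.adj_comm b a, and_iff_right_of_imp SimpleGraph.Adj.ne] using hab
      have := c.valid (v := ⟨a, ha⟩) (w := ⟨b, hb⟩) hG
      simpa [f] using this
    all_goals simp_all [f, padRel]
  have hc := (SimpleGraph.Coloring.mk f hf).colorable
  rwa [Fintype.card_sum, Fintype.card_fin, Fintype.card_fin, Nat.add_sub_cancel' hk'] at hc

/-- If a set of vertices containing the whole clique induces a `k'`-colorable subgraph of the padded
graph, then its trace on `G` only uses the two colors avoided by the clique. -/
theorem colorable_two_of_induce_fromRel_padRel {α : Type*} {G : SimpleGraph α} {k' q' : ℕ}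
    (hk' : 2 ≤ k') {S' : Set (α ⊕ (Fin (k' - 2) ⊕ Fin q'))}
    (hw : ∀ w, Sum.inr (Sum.inl w) ∈ S')
    (h : ((SimpleGraph.fromRel (padRel G k' q')).induce S').Colorable k') :
    (G.induce (Sum.inl ⁻¹' S')).Colorable 2 := by
  classical
  obtain ⟨c⟩ := h
  let f : Fin (k' - 2) → Fin k' := fun w => c ⟨Sum.inr (Sum.inl w), hw w⟩
  have hf : Function.Injective f := by
    intro a b hab
    by_contra hne
    exact c.valid (v := ⟨_, hw a⟩) (w := ⟨_, hw b⟩) (by simp [padRel, hne]) hab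
  let d : (G.induce (Sum.inl ⁻¹' S')).Coloring {x // x ∉ Set.range f} :=
    SimpleGraph.Coloring.mk
      (fun v => ⟨c ⟨Sum.inl v.1, v.2⟩, by
        rintro ⟨w, hwv⟩
        exact c.valid (v := ⟨_, hw w⟩) (w := ⟨_, v.2⟩) (by simp [padRel]) hwv⟩)
      (by
        intro a b hab heq
        have hG : G.Adj a b := hab
        exact c.valid (v := ⟨_, a.2⟩) (w := ⟨_, b.2⟩)
          (by simp [padRel, hG, hG.ne]) (congrArg Subtype.val heq))
  have hd := d.colorable
  have hcard : Fintype.card {x // x ∉ Set.range f} = 2 := by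
    have hr : Fintype.card {x // x ∈ Set.range f} = k' - 2 := by
      exact (Fintype.card_congr (Equiv.ofInjective f hf)).symm.trans (Fintype.card_fin _)
    rw [Fintype.card_subtype_compl, hr, Fintype.card_fin]
    omega
  rwa [hcard] at hd

/-- Correctness of the padding reduction in the proof of Corollary 1 (PCP is
NP-complete for all constants `q' ≥ 2` and `k' ≥ 2`): for a graph `G` with a
`p`-partition `P`, there is a selection of `P` inducing a 2-colorable subgraph
of `G` iff there is a selection of the partition
`𝒱' = 𝒱 ∪ {{w₁},…,{w_{k'-2}}, {u₁,…,u_{q'}}}` inducing a `k'`-colorable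
subgraph of the padded graph `G'`. -/
theorem pcp_padding_reduction {α : Type*} (G : SimpleGraph α) {p : ℕ}
    (P : Fin p → Set α)
    (hdisj : ∀ i j, i ≠ j → Disjoint (P i) (P j))
    (hcover : ∀ v : α, ∃ i, v ∈ P i)
    (k' q' : ℕ) (hk' : 2 ≤ k') (hq' : 2 ≤ q') :
    (∃ S : Set α, (∀ i, ∃! v, v ∈ S ∧ v ∈ P i) ∧ (G.induce S).Colorable 2)
    ↔ (∃ S' : Set (α ⊕ (Fin (k' - 2) ⊕ Fin q')),
        (∀ i, ∃! v : α, Sum.inl v ∈ S' ∧ v ∈ P i) ∧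
        (∀ w : Fin (k' - 2), Sum.inr (Sum.inl w) ∈ S') ∧
        (∃! u : Fin q', Sum.inr (Sum.inr u) ∈ S') ∧
        ((SimpleGraph.fromRel (padRel G k' q')).induce S').Colorable k') := by
  constructor
  · rintro ⟨S, hS, hc⟩
    let u₀ : Fin q' := ⟨0, by omega⟩
    let S' : Set (α ⊕ (Fin (k' - 2) ⊕ Fin q')) :=
      {x | Sum.elim (· ∈ S) (Sum.elim (fun _ => True) (· = u₀)) x}
    exact ⟨S', hS, fun _ => trivial, ⟨u₀, rfl, fun _ h => h⟩,
      colorable_induce_fromRel_padRel (S' := S') hk' hc⟩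
  · rintro ⟨S', hS, hw, -, hc⟩
    exact ⟨Sum.inl ⁻¹' S', hS, colorable_two_of_induce_fromRel_padRel hk' hw hc⟩
end

section
/- Let G = (V,E) be a simple undirected graph and let k ≥ 1 and k_I ≥ 1 be integers. Construct the graph G' consisting of a complete graph K_{k-1} on new vertices w_1, ..., w_{k-1} (empty when k = 1) and k_I disjoint copies G_1, ..., G_{k_I} of G, with the following additional edges: for any two vertices v_i ∈ V_i and v_j ∈ V_j lying in different copies (i ≠ j), add the edge (v_i, v_j) whenever v_i and v_j correspond to the same vertex of G or to a pair of adjacent vertices of G; and add all edges between {w_1,...,w_{k-1}} and V_1 ∪ ... ∪ V_{k_I}. Take the partition 𝒱 = {V_1, V_2, ..., V_{k_I}, {w_1}, {w_2}, ..., {w_{k-1}}} (so p = k_I + k − 1). Then G has an independent set of size k_I if and only if there exists a selection S of 𝒱 such that G'[S] is k-colorable. -/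
/-- The base (pre-symmetrization) edge relation of the graph `G'` in the proof
of Theorem 7: `G'` consists of `k_I` disjoint copies of `G` (the vertex
`Sum.inl (i, v)` is the copy of `v ∈ G` in the `i`-th copy) and a complete
graph `K_{k-1}` on the vertices `w₁,…,w_{k-1}` (the `Sum.inr` vertices).
Within a copy, edges are those of `G`; two vertices in different copies are
adjacent whenever they correspond to the same vertex of `G` or to a pair of
adjacent vertices of `G`; and every `w` vertex is joined to every copy
vertex. -/
def copiesRel {α : Type*} (G : SimpleGraph α) (kI k : ℕ) :
    ((Fin kI × α) ⊕ Fin (k - 1)) → ((Fin kI × α) ⊕ Fin (k - 1)) → Prop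
  | Sum.inl (i, v), Sum.inl (j, w) => G.Adj v w ∨ (i ≠ j ∧ v = w)
  | Sum.inl _, Sum.inr _ => True
  | Sum.inr _, Sum.inr _ => True
  | _, _ => False

/-- Correctness of the FPT reduction in the proof of Theorem 7 (PCP
parameterized by `p` is W[1]-hard for each fixed `k ≥ 1`): `G` has an
independent set of size `k_I` iff the graph `G'` has a selection `S` of the
partition `𝒱 = {V₁,…,V_{k_I}, {w₁},…,{w_{k-1}}}` (where `Vᵢ` is the `i`-th
copy of the vertex set of `G`) such that the induced subgraph `G'[S]` is
`k`-colorable. -/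
theorem pcp_reduction_from_independent_set {α : Type*}
    (G : SimpleGraph α) (k kI : ℕ) (hk : 1 ≤ k) (hkI : 1 ≤ kI) :
    (∃ I : Finset α, I.card = kI ∧ ∀ v ∈ I, ∀ w ∈ I, ¬ G.Adj v w)
    ↔ (∃ S : Set ((Fin kI × α) ⊕ Fin (k - 1)),
        (∀ i : Fin kI, ∃! v : α, Sum.inl (i, v) ∈ S) ∧
        (∀ w : Fin (k - 1), Sum.inr w ∈ S) ∧
        ((SimpleGraph.fromRel (copiesRel G kI k)).induce S).Colorable k) := by
  classical
  constructor
  · rintro ⟨I, hI, hind⟩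
    let e : Fin kI ≃ I := (I.equivFinOfCardEq hI).symm
    refine ⟨{x | ∀ i v, x = Sum.inl (i, v) → v = e i}, fun i => ⟨e i, ?_, ?_⟩, ?_, ?_⟩
    · rintro j v h
      simp only [Sum.inl.injEq, Prod.mk.injEq] at h
      rw [← h.1, ← h.2]
    · intro v hv
      exact hv i v rfl
    · rintro w i v h
      cases h
    · let c : (Fin kI × α) ⊕ Fin (k - 1) → Fin k :=
        Sum.elim (fun _ => ⟨0, hk⟩) (fun w => ⟨w + 1, by omega⟩)
      refine ⟨SimpleGraph.Coloring.mk (fun x => c x) ?_⟩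
      rintro ⟨x, hx⟩ ⟨y, hy⟩ hxy
      rw [SimpleGraph.comap_adj, SimpleGraph.fromRel_adj] at hxy
      obtain ⟨hne, hrel⟩ := hxy
      rcases x with ⟨i, v⟩ | w <;> rcases y with ⟨j, u⟩ | z
      · exfalso
        have hv : v = e i := hx i v rfl
        have hu : u = e j := hy j u rfl
        have hvI : v ∈ I := hv ▸ (e i).2
        have huI : u ∈ I := hu ▸ (e j).2
        have hij : v = u → i = j := fun h => e.injective (Subtype.ext (by rw [← hv, ← hu, h]))
        rcases hrel with (h | ⟨h, h'⟩) | (h | ⟨h, h'⟩)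
        · exact hind _ hvI _ huI h
        · exact h (hij h')
        · exact hind _ huI _ hvI h
        · exact h (hij h'.symm).symm
      · simp [c]
      · simp [c]
      · intro h
        apply hne
        simpa [c, Fin.ext_iff] using h
  · rintro ⟨S, hcopy, hw, ⟨C⟩⟩
    choose f hf _ using hcopy
    have valid : ∀ x y (hx : x ∈ S) (hy : y ∈ S), x ≠ y → copiesRel G kI k x y →
        C ⟨x, hx⟩ ≠ C ⟨y, hy⟩ := by
      intro x y hx hy hne h
      apply C.valid
      rw [SimpleGraph.comap_adj, SimpleGraph.fromRel_adj]
      exact ⟨hne, Or.inl h⟩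
    have mono : ∀ i j, C ⟨_, hf i⟩ = C ⟨_, hf j⟩ := by
      intro i j
      by_contra hne
      let g : Fin (k - 1) ⊕ Bool → Fin k :=
        Sum.elim (fun w => C ⟨_, hw w⟩) (fun b => C ⟨_, hf (if b then i else j)⟩)
      have hg : Function.Injective g := by
        refine Function.Injective.sumElim ?_ ?_ ?_
        · intro a b hab
          by_contra h
          exact valid _ _ (hw a) (hw b) (by simpa using h) trivial hab
        · rintro (_ | _) (_ | _) hab
          · rfl
          · exact absurd hab.symm hne
          · exact absurd hab hne
          · rfl
        · intro a b
          exact (valid _ _ (hf (if b then i else j)) (hw a) (by simp) trivial).symm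
      have := Fintype.card_le_of_injective g hg
      simp only [Fintype.card_sum, Fintype.card_fin, Fintype.card_bool] at this
      omega
    have hinj : Function.Injective f := by
      intro i j hij
      by_contra h
      exact valid _ _ (hf i) (hf j) (by simp [h]) (Or.inr ⟨h, hij⟩) (mono i j)
    refine ⟨Finset.univ.image f, ?_, ?_⟩
    · rw [Finset.card_image_of_injective _ hinj, Finset.card_univ, Fintype.card_fin]
    · simp only [Finset.mem_image, Finset.mem_univ, true_and]
      rintro _ ⟨i, rfl⟩ _ ⟨j, rfl⟩ h
      refine valid _ _ (hf i) (hf j) ?_ (Or.inl h) (mono i j)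
      intro hij
      simp only [Sum.inl.injEq, Prod.mk.injEq] at hij
      exact h.ne hij.2
end

section
/- Let G = (V,E) be a simple undirected graph and define f : 𝒫(V) → ℤ by f(S) = 1 if S is an independent set of G (equivalently, G[S] is 1-colorable) and f(S) = 0 otherwise. Let f^{*k} denote the k-fold subset convolution of f, where (g*h)(S) = ∑_{T ⊆ S} g(T)·h(S \ T). Then for every S ⊆ V and every integer k ≥ 1, the induced subgraph G[S] is k-colorable if and only if f^{*k}(S) > 0. -/
/-- The subset convolution of two functions on subsets of a finite set:
`(g * h)(S) = ∑_{T ⊆ S} g(T) · h(S \ T)`. -/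
def subConv {α : Type*} [DecidableEq α] (g h : Finset α → ℤ) :
    Finset α → ℤ :=
  fun S => ∑ T ∈ S.powerset, g T * h (S \ T)

/-- The `k`-fold iterated subset convolution `f^{*k} = f * f * ⋯ * f`
(`f^{*0}` is the unit of subset convolution, so `f^{*1} = f`). -/
def iterConv {α : Type*} [DecidableEq α] (f : Finset α → ℤ) :
    ℕ → Finset α → ℤ
  | 0 => fun S => if S = ∅ then 1 else 0
  | k + 1 => subConv f (iterConv f k)

theorem subConv_nonneg {α : Type*} [DecidableEq α] {g h : Finset α → ℤ}
    (hg : ∀ S, 0 ≤ g S) (hh : ∀ S, 0 ≤ h S) (S : Finset α) : 0 ≤ subConv g h S :=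
  Finset.sum_nonneg fun T _ => mul_nonneg (hg T) (hh (S \ T))

theorem subConv_pos_iff {α : Type*} [DecidableEq α] {g h : Finset α → ℤ}
    (hg : ∀ S, 0 ≤ g S) (hh : ∀ S, 0 ≤ h S) (S : Finset α) :
    0 < subConv g h S ↔ ∃ T ⊆ S, 0 < g T ∧ 0 < h (S \ T) := by
  have key : ∀ T, 0 < g T * h (S \ T) ↔ 0 < g T ∧ 0 < h (S \ T) := fun T =>
    ⟨fun hpos => ⟨pos_of_mul_pos_left hpos (hh _), pos_of_mul_pos_right hpos (hg _)⟩,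
      fun hpos => mul_pos hpos.1 hpos.2⟩
  rw [subConv, Finset.sum_pos_iff_of_nonneg fun T _ => mul_nonneg (hg T) (hh _)]
  simp [key]

theorem iterConv_nonneg {α : Type*} [DecidableEq α] {f : Finset α → ℤ}
    (hf : ∀ S, 0 ≤ f S) (k : ℕ) (S : Finset α) : 0 ≤ iterConv f k S := by
  induction k generalizing S with
  | zero => simp only [iterConv]; split_ifs <;> simp
  | succ k ih => exact subConv_nonneg hf ih S

namespace SimpleGraph

theorem induce_colorable_iff_exists_nat {α : Type*} (G : SimpleGraph α) (s : Set α) (k : ℕ) :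
    (G.induce s).Colorable k ↔
      ∃ c : α → ℕ, (∀ v ∈ s, c v < k) ∧ ∀ v ∈ s, ∀ w ∈ s, G.Adj v w → c v ≠ c w := by
  classical
  constructor
  · rintro ⟨C⟩
    refine ⟨fun v => if hv : v ∈ s then C ⟨v, hv⟩ else 0, fun v hv => ?_, fun v hv w hw hvw => ?_⟩
    · simp [hv]
    · have hadj : (G.induce s).Adj ⟨v, hv⟩ ⟨w, hw⟩ := hvw
      simpa [hv, hw, Fin.val_inj] using C.valid hadj
  · rintro ⟨c, hlt, hne⟩
    exact ⟨Coloring.mk (fun v => ⟨c v, hlt v v.2⟩) fun {v w} hvw heq =>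
      hne v v.2 w w.2 hvw (Fin.val_eq_of_eq heq)⟩

/-- An induced subgraph is `(k + 1)`-colorable iff removing some independent set leaves a
`k`-colorable one. -/
theorem induce_colorable_succ_iff {α : Type*} [DecidableEq α] (G : SimpleGraph α)
    (S : Finset α) (k : ℕ) :
    (G.induce (S : Set α)).Colorable (k + 1) ↔
      ∃ T ⊆ S, (∀ v ∈ T, ∀ w ∈ T, ¬ G.Adj v w) ∧
        (G.induce ((S \ T : Finset α) : Set α)).Colorable k := by
  simp only [induce_colorable_iff_exists_nat, Finset.mem_coe]
  constructor
  · rintro ⟨c, hlt, hne⟩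
    refine ⟨S.filter (c · = k), Finset.filter_subset _ _, ?_, c, ?_, ?_⟩ <;> grind
  · rintro ⟨T, hTS, hT, c, hlt, hne⟩
    refine ⟨fun v => if v ∈ T then k else c v, ?_, ?_⟩ <;> grind

end SimpleGraph

/-- Theorem 10 of the paper (correctness of the subset-convolution algorithm):
with `f` the 0/1-indicator of independent sets of `G`, for every vertex subset
`S` and every `k ≥ 1`, the induced subgraph `G[S]` is `k`-colorable iff
`f^{*k}(S) > 0`. -/
theorem colorable_iff_iterConv_pos {α : Type*} [Fintype α] [DecidableEq α]
    (G : SimpleGraph α) [DecidableRel G.Adj]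
    (f : Finset α → ℤ)
    (hf : ∀ S : Finset α,
      f S = if (∀ v ∈ S, ∀ w ∈ S, ¬ G.Adj v w) then 1 else 0)
    (k : ℕ) (hk : 1 ≤ k) (S : Finset α) :
    (G.induce (S : Set α)).Colorable k ↔ 0 < iterConv f k S := by
  have hnonneg : ∀ S, 0 ≤ f S := fun S => by rw [hf]; split_ifs <;> simp
  have hpos : ∀ S, 0 < f S ↔ ∀ v ∈ S, ∀ w ∈ S, ¬ G.Adj v w := fun S => by
    rw [hf]; split_ifs with h <;> simp only [h, zero_lt_one, lt_irrefl]; simpa using h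
  clear hk
  induction k generalizing S with
  | zero =>
    simp only [SimpleGraph.induce_colorable_iff_exists_nat, iterConv]
    split_ifs with h
    · simp [h]
    · obtain ⟨v, hv⟩ := Finset.nonempty_iff_ne_empty.mpr h
      simp only [lt_irrefl, iff_false]
      rintro ⟨c, hlt, -⟩
      exact Nat.not_lt_zero _ (hlt v hv)
  | succ k ih =>
    rw [G.induce_colorable_succ_iff, iterConv,
      subConv_pos_iff hnonneg (iterConv_nonneg hnonneg k)]
    simp only [hpos, ih]
end
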